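/- Let S be a finite nonempty set of states, let R : S → Finset S assign to each state s a nonempty set R(s) of successors, and let S₀ ⊆ S be a nonempty set of initial states. A lasso is a finite sequence (s₀, s₁, …, s_n, s_{n+1}) with n ≥ 0 such that s₀ ∈ S₀, the states s₀, …, s_n are pairwise distinct, s_{i+1} ∈ R(sᵢ) for every 0 ≤ i ≤ n, and s_{n+1} = sᵢ for some 0 ≤ i ≤ n. Assign to such a lasso the probability (1/|S₀|) · ∏_{i=0}^{n} 1/|R(sᵢ)|. Then the sum of these probabilities over the set of all lassos equals 1. -/

import Mathlib

/-- A lasso in the transition graph given by successor sets `R` with initial states `S₀`: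
a finite sequence `s₀, s₁, …, s_n, s_{n+1}` (represented as a list of length `≥ 2`, so
`n ≥ 0`) such that `s₀ ∈ S₀`, the states `s₀, …, s_n` are pairwise distinct, each
`s_{i+1}` is a successor of `s_i` (for `0 ≤ i ≤ n`), and the final state `s_{n+1}`
equals one of the previous states `s₀, …, s_n`. -/
def IsLasso {S : Type*} [DecidableEq S] (R : S → Finset S) (S₀ : Finset S)
    (l : List S) : Prop :=
  2 ≤ l.length ∧
  (∀ h : l ≠ [], l.head h ∈ S₀) ∧
  l.dropLast.Nodup ∧
  (∀ (i : ℕ) (h : i + 1 < l.length),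
      l.get ⟨i + 1, h⟩ ∈ R (l.get ⟨i, Nat.lt_of_succ_lt h⟩)) ∧
  (∀ h : l ≠ [], l.getLast h ∈ l.dropLast)

/-- The probability of a lasso `s₀, …, s_n, s_{n+1}`: the initial state is chosen
uniformly in `S₀` and at each step the next state is chosen uniformly among the
successors of the current state, i.e. `(1/|S₀|) · ∏_{i=0}^{n} 1/|R(sᵢ)|`. -/
noncomputable def lassoProb {S : Type*} (R : S → Finset S) (S₀ : Finset S)
    (l : List S) : ℝ :=
  (1 / (S₀.card : ℝ)) * (l.dropLast.map fun s => (1 : ℝ) / ((R s).card : ℝ)).prod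

namespace LassoAux

variable {S : Type*} [DecidableEq S]

def nxt (R : S → Finset S) : List S → Finset S
  | [] => ∅
  | a :: _ => R a

def ext (R : S → Finset S) (P : Finset (List S)) : Finset (List S) :=
  P.biUnion fun p => (nxt R p).image (fun b => b :: p)

def pth (R : S → Finset S) (S₀ : Finset S) : ℕ → Finset (List S)
  | 0 => S₀.image (fun s => [s])
  | n + 1 => (ext R (pth R S₀ n)).filter List.Nodup

def las (R : S → Finset S) (S₀ : Finset S) (n : ℕ) : Finset (List S) :=
  (ext R (pth R S₀ n)).filter (fun l => ¬ l.Nodup)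

lemma mem_ext (R : S → Finset S) (P : Finset (List S)) (l : List S) :
    l ∈ ext R P ↔ ∃ b a t, l = b :: a :: t ∧ a :: t ∈ P ∧ b ∈ R a := by
  simp only [ext, Finset.mem_biUnion, Finset.mem_image]
  constructor
  · rintro ⟨p, hp, b, hb, rfl⟩
    cases p with
    | nil => simp [nxt] at hb
    | cons a t => exact ⟨b, a, t, rfl, hp, hb⟩
  · rintro ⟨b, a, t, rfl, hp, hb⟩
    exact ⟨a :: t, hp, b, hb, rfl⟩

lemma mem_pth (R : S → Finset S) (S₀ : Finset S) (n : ℕ) (l : List S) :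
    l ∈ pth R S₀ n ↔ l.length = n + 1 ∧ l.Nodup ∧ l.IsChain (fun x y => x ∈ R y) ∧
      ∀ h : l ≠ [], l.getLast h ∈ S₀ := by
  induction n generalizing l with
  | zero =>
    simp only [pth, Finset.mem_image]
    constructor
    · rintro ⟨s, hs, rfl⟩
      simpa using hs
    · rintro ⟨h1, -, -, h⟩
      obtain ⟨s, rfl⟩ := List.length_eq_one_iff.1 h1
      exact ⟨s, by simpa using h, rfl⟩
  | succ n ih =>
    simp only [pth, Finset.mem_filter, mem_ext]
    constructor
    · rintro ⟨⟨b, a, t, rfl, hp, hb⟩, hn⟩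
      obtain ⟨h1, h2, h3, h4⟩ := (ih _).1 hp
      refine ⟨by simpa using h1, hn, ?_, ?_⟩
      · simp [h3, hb]
      · intro _
        simpa using h4 (by simp)
    · rintro ⟨h1, h2, h3, h4⟩
      match l, h1, h2, h3, h4 with
      | [], h1, _, _, _ => simp at h1
      | [x], h1, _, _, _ => simp at h1
      | b :: a :: t, h1, h2, h3, h4 =>
        rw [List.isChain_cons_cons] at h3
        refine ⟨⟨b, a, t, rfl, (ih _).2 ⟨by simpa using h1, h2.of_cons, h3.2, ?_⟩, h3.1⟩, h2⟩
        intro _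
        simpa using h4 (by simp)

lemma lassoProb_rev (R : S → Finset S) (S₀ : Finset S) (b : S) (p : List S) :
    lassoProb R S₀ (b :: p).reverse =
      (1 / (S₀.card : ℝ)) * (p.map fun s => (1 : ℝ) / ((R s).card : ℝ)).prod := by
  simp only [lassoProb, List.reverse_cons, List.dropLast_concat, List.map_reverse,
    List.prod_reverse]

lemma sum_ext (R : S → Finset S) (hR : ∀ s, (R s).Nonempty) (S₀ : Finset S)
    (P : Finset (List S)) (hP : [] ∉ P) :
    ∑ l ∈ ext R P, lassoProb R S₀ l.reverse = ∑ l ∈ P, lassoProb R S₀ l.reverse := by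
  rw [ext, Finset.sum_biUnion]
  · refine Finset.sum_congr rfl fun p hp => ?_
    rw [Finset.sum_image (by intro x _ y _ h; simpa using h)]
    cases p with
    | nil => exact absurd hp hP
    | cons a t =>
      have h0 : ((R a).card : ℝ) ≠ 0 := by
        simpa using (hR a).ne_empty
      simp only [lassoProb_rev, nxt, Finset.sum_const, List.map_cons, List.prod_cons,
        nsmul_eq_mul]
      field_simp
  · intro p _ q _ hpq
    rw [Function.onFun, Finset.disjoint_left]
    intro l h1 h2
    simp only [Finset.mem_image] at h1 h2
    obtain ⟨b, _, rfl⟩ := h1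
    obtain ⟨c, _, h⟩ := h2
    simp only [List.cons.injEq] at h
    exact hpq h.2.symm

lemma mem_las (R : S → Finset S) (S₀ : Finset S) (n : ℕ) (l : List S) :
    l ∈ las R S₀ n ↔ l.length = n + 2 ∧ IsLasso R S₀ l.reverse := by
  have key : ∀ m : List S, (∀ (i : ℕ) (h : i + 1 < m.length),
      m.get ⟨i + 1, h⟩ ∈ R (m.get ⟨i, Nat.lt_of_succ_lt h⟩)) ↔
      m.IsChain (fun x y => y ∈ R x) := by
    intro m
    rw [List.isChain_iff_getElem]
    simp
  simp only [las, Finset.mem_filter, mem_ext, mem_pth]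
  constructor
  · rintro ⟨⟨b, a, t, rfl, ⟨h1, h2, h3, h4⟩, hb⟩, hn⟩
    refine ⟨by simpa using h1, by simp, ?_, ?_, ?_, ?_⟩
    · intro _
      rw [List.head_reverse]
      simpa using h4 (by simp)
    · rw [List.reverse_cons, List.dropLast_concat]
      exact List.nodup_reverse.2 h2
    · rw [key, List.isChain_reverse, List.isChain_cons_cons]
      exact ⟨hb, h3⟩
    · intro _
      rw [List.nodup_cons] at hn
      simp only [List.reverse_cons (a := b), List.dropLast_concat, List.getLast_concat,
        List.mem_reverse]
      tauto
  · rintro ⟨h1, -, h2, h3, h4, h5⟩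
    match l, h1, h2, h3, h4, h5 with
    | [], h1, _, _, _, _ => simp at h1
    | [x], h1, _, _, _, _ => simp at h1
    | b :: a :: t, h1, h2, h3, h4, h5 =>
      rw [key, List.isChain_reverse, List.isChain_cons_cons] at h4
      rw [List.reverse_cons, List.dropLast_concat, List.nodup_reverse] at h3
      have h5 := h5 (by simp)
      simp only [List.reverse_cons (a := b), List.dropLast_concat, List.getLast_concat,
        List.mem_reverse] at h5
      have h2 := h2 (by simp)
      rw [List.head_reverse] at h2
      refine ⟨⟨b, a, t, rfl, ⟨by simpa using h1, h3, h4.2, ?_⟩, h4.1⟩, ?_⟩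
      · intro _
        simpa using h2
      · rw [List.nodup_cons]
        tauto

end LassoAux

/-- The probabilities of all lassos sum to `1`: the random walk that starts in a
uniformly random initial state, moves to a uniformly random successor at each step,
and stops as soon as a state is revisited, terminates with probability `1`. -/
theorem sum_lassoProb_eq_one {S : Type*} [Fintype S] [DecidableEq S]
    (R : S → Finset S) (hR : ∀ s, (R s).Nonempty)
    (S₀ : Finset S) (hS₀ : S₀.Nonempty) :
    ∑' l : {l : List S // IsLasso R S₀ l}, lassoProb R S₀ l.val = 1 := by
  classical
  have hset : {l : List S | IsLasso R S₀ l} =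
      ↑(((Finset.range (Fintype.card S)).biUnion (LassoAux.las R S₀)).image List.reverse) := by
    ext l
    simp only [Set.mem_setOf_eq, Finset.coe_image, Set.mem_image, Finset.mem_coe,
      Finset.mem_biUnion, Finset.mem_range, LassoAux.mem_las]
    constructor
    · intro h
      refine ⟨l.reverse, ⟨l.length - 2, ?_, ?_, by simpa using h⟩, by simp⟩
      · have := h.2.2.1.length_le_card
        have := h.1
        simp at *
        omega
      · have := h.1
        simp
        omega
    · rintro ⟨m, ⟨n, _, _, h⟩, rfl⟩
      exact h
  have h1 : ∑' l : {l : List S // IsLasso R S₀ l}, lassoProb R S₀ l.val =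
      ∑' l : ({l : List S | IsLasso R S₀ l} : Set (List S)), lassoProb R S₀ l.val := rfl
  rw [h1, hset]
  rw [Finset.tsum_subtype' _ (lassoProb R S₀),
    Finset.sum_image (by intro x _ y _ h; simpa using h), Finset.sum_biUnion]
  · have step : ∀ n, ∑ l ∈ LassoAux.las R S₀ n, lassoProb R S₀ l.reverse =
        ∑ l ∈ LassoAux.pth R S₀ n, lassoProb R S₀ l.reverse -
        ∑ l ∈ LassoAux.pth R S₀ (n + 1), lassoProb R S₀ l.reverse := by
      intro n
      rw [← LassoAux.sum_ext R hR S₀ (LassoAux.pth R S₀ n)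
        (by simp [LassoAux.mem_pth]), eq_sub_iff_add_eq, add_comm]
      exact Finset.sum_filter_add_sum_filter_not _ _ _
    rw [Finset.sum_congr rfl fun n _ => step n,
      Finset.sum_range_sub' (fun n => ∑ l ∈ LassoAux.pth R S₀ n, lassoProb R S₀ l.reverse)]
    have he : LassoAux.pth R S₀ (Fintype.card S) = ∅ := by
      rw [Finset.eq_empty_iff_forall_notMem]
      intro l hl
      rw [LassoAux.mem_pth] at hl
      have := hl.2.1.length_le_card
      omega
    have h0 : (S₀.card : ℝ) ≠ 0 := by
      simpa using hS₀.ne_empty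
    rw [he, Finset.sum_empty, sub_zero, LassoAux.pth,
      Finset.sum_image (by intro x _ y _ h; simpa using h)]
    simp only [LassoAux.lassoProb_rev, Finset.sum_const, List.map_nil, List.prod_nil,
      nsmul_eq_mul]
    field_simp
  · intro m _ n _ hmn
    rw [Function.onFun, Finset.disjoint_left]
    intro l h1 h2
    rw [LassoAux.mem_las] at h1 h2
    omega
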